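/- Let λ₂ ∈ ℂ, ξ_s ∈ ℂ \ {0}, and d₁, d₃, d₄ ∈ ℂ with −λ₂ ξ_s^{-1} + d₃ + d₄ ξ_s ≠ 0. The initial value problem dξ/dh = 2h / ((λ₂ξ^{-1} + d₁ + d₂ξ) h + (−λ₂ξ^{-1} + d₃ + d₄ξ)), ξ(0) = ξ_s, has a unique solution ξ(h) analytic near h = 0, and it satisfies ξ'(0) = 0 and ξ''(0) = 2 / (−λ₂ ξ_s^{-1} + d₃ + d₄ ξ_s) ≠ 0. Consequently h, as a function of ξ, has a square-root branch point at ξ_s: h(ξ) = h₁((ξ − ξ_s)^{1/2}) with h₁ analytic at 0, h₁(0) = 0, h₁'(0) ≠ 0. -/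

import Mathlib

open Filter

lemma aux_local_data (F : ℂ × ℂ → ℂ) (x₀ : ℂ) (hF : AnalyticAt ℂ F (0, x₀)) :
    ∃ r₀ K M : ℝ, 0 < r₀ ∧ 0 ≤ K ∧ 0 ≤ M ∧
      (∀ h x, ‖h‖ < r₀ → ‖x - x₀‖ < r₀ → DifferentiableAt ℂ F (h, x) ∧ ‖F (h, x)‖ ≤ M) ∧
      (∀ h x y, ‖h‖ < r₀ → ‖x - x₀‖ < r₀ → ‖y - x₀‖ < r₀ →
        ‖F (h, x) - F (h, y)‖ ≤ K * ‖x - y‖) := by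
  obtain ⟨K, t, ht, hK⟩ := (hF.contDiffAt (n := 1)).exists_lipschitzOnWith
  have h1 : ∀ᶠ p in nhds ((0 : ℂ), x₀), DifferentiableAt ℂ F p :=
    hF.eventually_analyticAt.mono fun p hp => hp.differentiableAt
  have h2 : ∀ᶠ p in nhds ((0 : ℂ), x₀), ‖F p‖ < ‖F (0, x₀)‖ + 1 :=
    (hF.continuousAt.norm).eventually_lt continuousAt_const (by simp)
  have h3 : ∀ᶠ p in nhds ((0 : ℂ), x₀), p ∈ t := ht
  obtain ⟨r₀, hr₀, hb⟩ := Metric.eventually_nhds_iff_ball.1 (h1.and (h2.and h3))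
  have key : ∀ h x, ‖h‖ < r₀ → ‖x - x₀‖ < r₀ → (h, x) ∈ Metric.ball ((0 : ℂ), x₀) r₀ := by
    intro h x hh hx
    rw [Metric.mem_ball, Prod.dist_eq]
    simp [dist_eq_norm, hh, hx]
  refine ⟨r₀, K, ‖F (0, x₀)‖ + 1, hr₀, K.2, by positivity, ?_, ?_⟩
  · intro h x hh hx
    have := hb _ (key h x hh hx)
    exact ⟨this.1, this.2.1.le⟩
  · intro h x y hh hx hy
    have := hK.dist_le_mul _ (hb _ (key h x hh hx)).2.2 _ (hb _ (key h y hh hy)).2.2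
    simpa [dist_eq_norm, Prod.dist_eq] using this

lemma aux_exists (F : ℂ × ℂ → ℂ) (x₀ : ℂ) (hF : AnalyticAt ℂ F (0, x₀)) :
    ∃ f : ℂ → ℂ, AnalyticAt ℂ f 0 ∧ f 0 = x₀ ∧
      ∀ᶠ h in nhds (0 : ℂ), deriv f h = F (h, f h) := by
  obtain ⟨r₀, K, M, hr₀, hK, hM, hd, hl⟩ := aux_local_data F x₀ hF
  obtain ⟨r, hr, hrr, hrM, hrK⟩ : ∃ r : ℝ, 0 < r ∧ r ≤ r₀ ∧ M * r ≤ r₀ / 2 ∧ K * r ≤ 1 / 2 := by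
    refine ⟨min r₀ (min (r₀ / 2 / (M + 1)) (1 / 2 / (K + 1))), by positivity, min_le_left _ _,
      ?_, ?_⟩
    · have : min r₀ (min (r₀ / 2 / (M + 1)) (1 / 2 / (K + 1))) ≤ r₀ / 2 / (M + 1) :=
        (min_le_right _ _).trans (min_le_left _ _)
      calc _ ≤ (M + 1) * (r₀ / 2 / (M + 1)) := by gcongr; linarith
        _ = _ := by field_simp
    · have : min r₀ (min (r₀ / 2 / (M + 1)) (1 / 2 / (K + 1))) ≤ 1 / 2 / (K + 1) :=
        (min_le_right _ _).trans (min_le_right _ _)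
      calc _ ≤ (K + 1) * (1 / 2 / (K + 1)) := by gcongr; linarith
        _ = _ := by field_simp
  let B := Metric.ball (0 : ℂ) r
  have hB : ∀ h ∈ B, ‖h‖ < r := fun h hh => by simpa [B] using hh
  have h0B : (0 : ℂ) ∈ B := by simp [B, hr]
  let S : Set (ℂ → ℂ) := {f | f 0 = x₀ ∧ DifferentiableOn ℂ f B ∧ ∀ h ∈ B, ‖f h - x₀‖ ≤ r₀ / 2}
  have step : ∀ f : S, ∃ g : S, ∀ h ∈ B, HasDerivAt g.1 (F (h, f.1 h)) h := by
    rintro ⟨f, hf0, hfd, hfb⟩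
    have hcomp : DifferentiableOn ℂ (fun h => F (h, f h)) B := by
      intro h hh
      have h1 := (hd h (f h) ((hB h hh).trans_le hrr) (by linarith [hfb h hh])).1
      have h2 : DifferentiableWithinAt ℂ (fun h => (h, f h)) B h :=
        differentiableWithinAt_id.prodMk (hfd h hh)
      exact h1.comp_differentiableWithinAt h h2
    obtain ⟨g, hg0, hg⟩ := hcomp.isExactOn_ball.with_val_at 0 x₀
    refine ⟨⟨g, hg0, fun h hh => (hg h hh).differentiableAt.differentiableWithinAt, ?_⟩, hg⟩
    intro h hh
    have := (convex_ball (0 : ℂ) r).norm_image_sub_le_of_norm_hasDerivWithin_le (C := M)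
      (fun x hx => (hg x hx).hasDerivWithinAt)
      (fun x hx => (hd x (f x) ((hB x hx).trans_le hrr) (by linarith [hfb x hx])).2) h0B hh
    rw [hg0, sub_zero] at this
    calc _ ≤ M * ‖h‖ := this
      _ ≤ M * r := by gcongr; exact (hB h hh).le
      _ ≤ _ := hrM
  choose T hT using step
  let f₀ : S := ⟨fun _ => x₀, rfl, differentiableOn_const _, fun h _ => by simp; positivity⟩
  let u : ℕ → S := fun n => T^[n] f₀
  have hu : ∀ n, u (n + 1) = T (u n) := fun n => Function.iterate_succ_apply' T n f₀
  have hbd : ∀ n, ∀ h ∈ B, dist ((u n).1 h) ((u (n + 1)).1 h) ≤ (2 * r₀) / 2 / 2 ^ n := by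
    intro n
    induction n with
    | zero =>
      intro h hh
      have h1 := (u 0).2.2.2 h hh
      have h2 := (u 1).2.2.2 h hh
      have : (u 0).1 h - (u 1).1 h = ((u 0).1 h - x₀) - ((u 1).1 h - x₀) := by ring
      rw [dist_eq_norm, zero_add, this]
      refine (norm_sub_le _ _).trans ?_
      simp only [pow_zero]
      linarith
    | succ n ih =>
      intro h hh
      have hder : ∀ x ∈ B, HasDerivWithinAt (fun z => (u (n + 1)).1 z - (u (n + 2)).1 z)
          (F (x, (u n).1 x) - F (x, (u (n + 1)).1 x)) B x := by
        intro x hx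
        have e1 := hT (u n) x hx
        have e2 := hT (u (n + 1)) x hx
        rw [← hu] at e1 e2
        exact (e1.sub e2).hasDerivWithinAt
      have := (convex_ball (0 : ℂ) r).norm_image_sub_le_of_norm_hasDerivWithin_le
        (C := K * ((2 * r₀) / 2 / 2 ^ n)) hder
        (fun x hx => (hl x _ _ ((hB x hx).trans_le hrr)
          (by linarith [(u n).2.2.2 x hx]) (by linarith [(u (n + 1)).2.2.2 x hx])).trans (by
            gcongr
            rw [← dist_eq_norm]
            exact ih x hx)) h0B hh
      simp only [(u (n + 1)).2.1, (u (n + 2)).2.1, sub_self, sub_zero] at this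
      rw [dist_eq_norm]
      calc _ ≤ K * ((2 * r₀) / 2 / 2 ^ n) * ‖h‖ := this
        _ ≤ K * ((2 * r₀) / 2 / 2 ^ n) * r := by gcongr; exact (hB h hh).le
        _ = (K * r) * ((2 * r₀) / 2 / 2 ^ n) := by ring
        _ ≤ (1 / 2) * ((2 * r₀) / 2 / 2 ^ n) := by gcongr
        _ = _ := by rw [pow_succ]; field_simp
  have hlim : ∀ h, ∃ y, h ∈ B → Tendsto (fun n => (u n).1 h) atTop (nhds y) := by
    intro h
    by_cases hh : h ∈ B
    · obtain ⟨y, hy⟩ := cauchySeq_tendsto_of_complete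
        (cauchySeq_of_le_geometric_two (fun n => hbd n h hh))
      exact ⟨y, fun _ => hy⟩
    · exact ⟨0, fun h' => absurd h' hh⟩
  choose f hf using hlim
  have hunif : TendstoUniformlyOn (fun n => (u n).1) f atTop B := by
    rw [Metric.tendstoUniformlyOn_iff]
    intro ε hε
    have : Tendsto (fun n : ℕ => 2 * r₀ * (1 / 2 : ℝ) ^ n) atTop (nhds (2 * r₀ * 0)) :=
      (tendsto_pow_atTop_nhds_zero_of_lt_one (by norm_num) (by norm_num)).const_mul _
    rw [mul_zero] at this
    filter_upwards [this.eventually_lt_const hε] with n hn h hh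
    have h1 := dist_le_of_le_geometric_two_of_tendsto (fun n => hbd n h hh) (hf h hh) n
    rw [dist_comm]
    refine h1.trans_lt ?_
    rw [one_div, inv_pow, ← div_eq_mul_inv] at hn
    exact hn
  have hdn : ∀ᶠ n in atTop, DifferentiableOn ℂ ((fun n => (u n).1) n) B :=
    Eventually.of_forall fun n => (u n).2.2.1
  have hfd := hunif.tendstoLocallyUniformlyOn.differentiableOn hdn Metric.isOpen_ball
  have hfder := hunif.tendstoLocallyUniformlyOn.deriv hdn Metric.isOpen_ball
  have hBn : B ∈ nhds (0 : ℂ) := Metric.ball_mem_nhds _ hr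
  refine ⟨f, hfd.analyticAt hBn, ?_, ?_⟩
  · refine tendsto_nhds_unique (hf 0 h0B) ?_
    simp only [(u _).2.1]
    exact tendsto_const_nhds
  · filter_upwards [hBn] with h hh
    have t1 : Tendsto (fun n => deriv (u (n + 1)).1 h) atTop (nhds (deriv f h)) :=
      (hfder.tendsto_at hh).comp (tendsto_add_atTop_nat 1)
    have e : ∀ n, deriv (u (n + 1)).1 h = F (h, (u n).1 h) := fun n => by
      rw [hu]; exact (hT (u n) h hh).deriv
    simp only [e] at t1
    have hfb : ‖f h - x₀‖ ≤ r₀ / 2 :=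
      le_of_tendsto ((hf h hh).sub_const x₀).norm
        (Eventually.of_forall fun n => (u n).2.2.2 h hh)
    have hc := (hd h (f h) ((hB h hh).trans_le hrr) (by linarith)).1.continuousAt
    have t2 : Tendsto (fun n => F (h, (u n).1 h)) atTop (nhds (F (h, f h))) :=
      hc.tendsto.comp (tendsto_const_nhds.prodMk_nhds (hf h hh))
    exact tendsto_nhds_unique t1 t2

lemma aux_unique (F : ℂ × ℂ → ℂ) (x₀ : ℂ) (hF : AnalyticAt ℂ F (0, x₀)) (f g : ℂ → ℂ)
    (hf : AnalyticAt ℂ f 0) (hg : AnalyticAt ℂ g 0) (hf0 : f 0 = x₀) (hg0 : g 0 = x₀)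
    (hf' : ∀ᶠ h in nhds (0 : ℂ), deriv f h = F (h, f h))
    (hg' : ∀ᶠ h in nhds (0 : ℂ), deriv g h = F (h, g h)) : g =ᶠ[nhds 0] f := by
  obtain ⟨r₀, K, M, hr₀, hK, hM, hd, hl⟩ := aux_local_data F x₀ hF
  have near : ∀ k : ℂ → ℂ, AnalyticAt ℂ k 0 → k 0 = x₀ →
      ∀ᶠ h in nhds (0 : ℂ), DifferentiableAt ℂ k h ∧ ‖k h - x₀‖ < r₀ := by
    intro k hk hk0
    refine (hk.eventually_analyticAt.mono fun p hp => hp.differentiableAt).and ?_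
    exact ((hk.continuousAt.sub continuousAt_const).norm).eventually_lt continuousAt_const
      (by simpa [hk0] using hr₀)
  obtain ⟨r₁, hr₁, hb⟩ := Metric.eventually_nhds_iff_ball.1
    (hf'.and (hg'.and ((near f hf hf0).and (near g hg hg0))))
  obtain ⟨r, hr, hrr, hrr1, hrK⟩ : ∃ r : ℝ, 0 < r ∧ r ≤ r₀ ∧ r ≤ r₁ ∧ K * r ≤ 1 / 2 := by
    refine ⟨min r₀ (min r₁ (1 / 2 / (K + 1))), by positivity, min_le_left _ _,
      (min_le_right _ _).trans (min_le_left _ _), ?_⟩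
    have : min r₀ (min r₁ (1 / 2 / (K + 1))) ≤ 1 / 2 / (K + 1) :=
      (min_le_right _ _).trans (min_le_right _ _)
    calc _ ≤ (K + 1) * (1 / 2 / (K + 1)) := by gcongr; linarith
      _ = _ := by field_simp
  let B := Metric.ball (0 : ℂ) r
  have hB : ∀ h ∈ B, ‖h‖ < r := fun h hh => by simpa [B] using hh
  have h0B : (0 : ℂ) ∈ B := by simp [B, hr]
  replace hb : ∀ h ∈ B, _ := fun h hh => hb h (Metric.ball_subset_ball hrr1 hh)
  have bound : ∀ n : ℕ, ∀ h ∈ B, ‖g h - f h‖ ≤ 2 * r₀ * (1 / 2 : ℝ) ^ n := by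
    intro n
    induction n with
    | zero =>
      intro h hh
      obtain ⟨-, -, ⟨-, h1⟩, -, h2⟩ := hb h hh
      have : g h - f h = (g h - x₀) - (f h - x₀) := by ring
      rw [this]
      refine (norm_sub_le _ _).trans ?_
      simp only [pow_zero]
      linarith
    | succ n ih =>
      intro h hh
      have hder : ∀ x ∈ B, HasDerivWithinAt (fun z => g z - f z)
          (F (x, g x) - F (x, f x)) B x := by
        intro x hx
        obtain ⟨h1, h2, ⟨h3, -⟩, h4, -⟩ := hb x hx
        rw [← h1, ← h2]
        exact (h4.hasDerivAt.sub h3.hasDerivAt).hasDerivWithinAt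
      have := (convex_ball (0 : ℂ) r).norm_image_sub_le_of_norm_hasDerivWithin_le
        (C := K * (2 * r₀ * (1 / 2 : ℝ) ^ n)) hder
        (fun x hx => (hl x _ _ ((hB x hx).trans_le hrr)
          (hb x hx).2.2.2.2 (hb x hx).2.2.1.2).trans (by
            gcongr
            exact ih x hx)) h0B hh
      simp only [hf0, hg0, sub_self, sub_zero] at this
      calc _ ≤ K * (2 * r₀ * (1 / 2 : ℝ) ^ n) * ‖h‖ := this
        _ ≤ K * (2 * r₀ * (1 / 2 : ℝ) ^ n) * r := by gcongr; exact (hB h hh).le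
        _ = (K * r) * (2 * r₀ * (1 / 2 : ℝ) ^ n) := by ring
        _ ≤ (1 / 2) * (2 * r₀ * (1 / 2 : ℝ) ^ n) := by gcongr
        _ = _ := by rw [pow_succ]; ring
  have ht : Tendsto (fun n : ℕ => 2 * r₀ * (1 / 2 : ℝ) ^ n) atTop (nhds (2 * r₀ * 0)) :=
    (tendsto_pow_atTop_nhds_zero_of_lt_one (by norm_num) (by norm_num)).const_mul _
  rw [mul_zero] at ht
  filter_upwards [Metric.ball_mem_nhds (0 : ℂ) hr] with h hh
  have : ‖g h - f h‖ ≤ 0 := ge_of_tendsto' ht fun n => bound n h hh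
  exact sub_eq_zero.1 (norm_le_zero_iff.1 this)

lemma aux_sqrt (f : ℂ → ℂ) (x₀ : ℂ) (hf : AnalyticAt ℂ f 0) (hf0 : f 0 = x₀)
    (h1 : deriv f 0 = 0) (h2 : deriv (deriv f) 0 ≠ 0) :
    ∃ h₁ : ℂ → ℂ, AnalyticAt ℂ h₁ 0 ∧ h₁ 0 = 0 ∧ deriv h₁ 0 ≠ 0 ∧
        ∀ᶠ w in nhds (0:ℂ), f (h₁ w) = x₀ + w ^ 2 := by
  have hp : AnalyticAt ℂ (fun z => f z - x₀) 0 := hf.sub analyticAt_const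
  have hd : deriv (fun z => f z - x₀) = deriv f := by ext z; simp
  have hord : analyticOrderAt (fun z => f z - x₀) 0 = (2 : ℕ) := by
    rw [analyticOrderAt_eq_nat_iff_iteratedDeriv_eq_zero hp]
    constructor
    · intro k hk
      interval_cases k
      · simp [hf0]
      · rw [iteratedDeriv_one, hd, h1]
    · rw [iteratedDeriv_succ', iteratedDeriv_one, hd]
      exact h2
  obtain ⟨g, hg, hg0, hfg⟩ := hp.analyticOrderAt_eq_natCast.1 hord
  obtain ⟨c, hc⟩ : ∃ c : ℂ, c ^ 2 = g 0 := IsAlgClosed.exists_pow_nat_eq _ (by norm_num)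
  have hc0 : c ≠ 0 := by rintro rfl; exact hg0 (by simpa using hc.symm)
  have hq : AnalyticAt ℂ (fun z => g z / g 0) 0 := hg.div_const
  have hlog : AnalyticAt ℂ (fun z => Complex.log (g z / g 0)) 0 :=
    hq.clog (by simp [hg0])
  let s : ℂ → ℂ := fun z => c * Complex.exp (Complex.log (g z / g 0) / 2)
  have hs : AnalyticAt ℂ s 0 := analyticAt_const.mul (hlog.div_const.cexp)
  have hs0 : s 0 = c := by simp [s, hg0]
  have hsq : ∀ᶠ z in nhds (0 : ℂ), s z ^ 2 = g z := by
    filter_upwards [hg.continuousAt.eventually_ne hg0] with z hz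
    have : Complex.exp (Complex.log (g z / g 0) / 2) ^ 2 = g z / g 0 := by
      rw [← Complex.exp_nat_mul]
      push_cast
      rw [mul_div_cancel₀ _ (by norm_num : (2 : ℂ) ≠ 0), Complex.exp_log (div_ne_zero hz hg0)]
    simp only [s]
    rw [mul_pow, this, hc]
    field_simp
  let φ : ℂ → ℂ := fun z => z * s z
  have hφ : AnalyticAt ℂ φ 0 := analyticAt_id.mul hs
  have hφ0 : φ 0 = 0 := by simp [φ]
  have hφd : deriv φ 0 = c := by
    have := (hasDerivAt_id (0 : ℂ)).mul hs.differentiableAt.hasDerivAt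
    have h' : HasDerivAt φ (1 * s 0 + id 0 * deriv s 0) 0 := this
    rw [h'.deriv, hs0]; simp
  have hφd0 : deriv φ 0 ≠ 0 := hφd ▸ hc0
  let k := hφ.hasStrictDerivAt.localInverse φ (deriv φ 0) 0 hφd0
  have hka : AnalyticAt ℂ k 0 := by
    have := hφ.analyticAt_localInverse hφd0
    rwa [hφ0] at this
  have hkd : HasStrictDerivAt k (deriv φ 0)⁻¹ 0 := by
    have := hφ.hasStrictDerivAt.to_localInverse hφd0
    rwa [hφ0] at this
  have hk0 : k 0 = 0 := by
    have := (hφ.hasStrictDerivAt.eventually_left_inverse hφd0).self_of_nhds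
    rwa [hφ0] at this
  have hkr : ∀ᶠ w in nhds (0 : ℂ), φ (k w) = w := by
    have := hφ.hasStrictDerivAt.eventually_right_inverse hφd0
    rwa [hφ0] at this
  refine ⟨k, hka, hk0, ?_, ?_⟩
  · rw [hkd.hasDerivAt.deriv]; exact inv_ne_zero hφd0
  · have hkt : Tendsto k (nhds 0) (nhds 0) := by
      have := hka.continuousAt.tendsto
      rwa [hk0] at this
    filter_upwards [hkr, hkt.eventually hfg, hkt.eventually hsq] with w a b d
    have : f (k w) = x₀ + (f (k w) - x₀) := by ring
    rw [this, b, ← d]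
    congr 1
    conv_rhs => rw [← a]
    simp only [φ, sub_zero, smul_eq_mul]
    ring

theorem stmt_19 (lam₂ ξs d₁ d₂ d₃ d₄ : ℂ) (hξs : ξs ≠ 0)
    (hD : -lam₂ / ξs + d₃ + d₄ * ξs ≠ 0) :
    ∃ ξf : ℂ → ℂ, AnalyticAt ℂ ξf 0 ∧ ξf 0 = ξs ∧
      (∀ᶠ h in nhds (0:ℂ), deriv ξf h =
        2 * h / ((lam₂ / ξf h + d₁ + d₂ * ξf h) * h + (-lam₂ / ξf h + d₃ + d₄ * ξf h))) ∧
      deriv ξf 0 = 0 ∧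
      deriv (deriv ξf) 0 = 2 / (-lam₂ / ξs + d₃ + d₄ * ξs) ∧
      2 / (-lam₂ / ξs + d₃ + d₄ * ξs) ≠ 0 ∧
      (∀ ξg : ℂ → ℂ, AnalyticAt ℂ ξg 0 → ξg 0 = ξs →
        (∀ᶠ h in nhds (0:ℂ), deriv ξg h =
          2 * h / ((lam₂ / ξg h + d₁ + d₂ * ξg h) * h + (-lam₂ / ξg h + d₃ + d₄ * ξg h))) →
        ξg =ᶠ[nhds (0:ℂ)] ξf) ∧
      ∃ h₁ : ℂ → ℂ, AnalyticAt ℂ h₁ 0 ∧ h₁ 0 = 0 ∧ deriv h₁ 0 ≠ 0 ∧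
        ∀ᶠ w in nhds (0:ℂ), ξf (h₁ w) = ξs + w ^ 2 := by
  let D : ℂ × ℂ → ℂ := fun p =>
    (lam₂ / p.2 + d₁ + d₂ * p.2) * p.1 + (-lam₂ / p.2 + d₃ + d₄ * p.2)
  have hDa : AnalyticAt ℂ D (0, ξs) := by
    have hs : AnalyticAt ℂ (fun p : ℂ × ℂ => p.2) (0, ξs) := analyticAt_snd
    have ht : AnalyticAt ℂ (fun p : ℂ × ℂ => p.1) (0, ξs) := analyticAt_fst
    exact ((((analyticAt_const.div hs hξs).add analyticAt_const).add
      (analyticAt_const.mul hs)).mul ht).add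
      (((analyticAt_const.div hs hξs).add analyticAt_const).add (analyticAt_const.mul hs))
  have hD0 : D (0, ξs) = -lam₂ / ξs + d₃ + d₄ * ξs := by simp [D]
  have hDne : D (0, ξs) ≠ 0 := hD0 ▸ hD
  let F : ℂ × ℂ → ℂ := fun p => 2 * p.1 / D p
  have hF : AnalyticAt ℂ F (0, ξs) :=
    (analyticAt_const.mul analyticAt_fst).div hDa hDne
  obtain ⟨f, hfa, hf0, hfd⟩ := aux_exists F ξs hF
  have hd0 : deriv f 0 = 0 := by
    rw [hfd.self_of_nhds]; simp [F]
  have hd2 : deriv (deriv f) 0 = 2 / (-lam₂ / ξs + d₃ + d₄ * ξs) := by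
    have hq : DifferentiableAt ℂ (fun h => 2 / D (h, f h)) 0 := by
      have hDa' : DifferentiableAt ℂ D (0, f 0) := by rw [hf0]; exact hDa.differentiableAt
      have : DifferentiableAt ℂ (fun h => D (h, f h)) 0 :=
        hDa'.comp (0 : ℂ) (differentiableAt_id.prodMk hfa.differentiableAt)
      exact (differentiableAt_const _).div this (by rw [hf0]; exact hDne)
    have h1 : HasDerivAt (fun h => h * (2 / D (h, f h)))
        (1 * (2 / D (0, f 0)) + 0 * deriv (fun h => 2 / D (h, f h)) 0) 0 :=
      (hasDerivAt_id (0 : ℂ)).mul hq.hasDerivAt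
    have he : deriv f =ᶠ[nhds 0] fun h => h * (2 / D (h, f h)) := by
      filter_upwards [hfd] with h hh
      rw [hh]; simp only [F]; ring
    rw [he.deriv_eq, h1.deriv, hf0, hD0]; ring
  have hne : 2 / (-lam₂ / ξs + d₃ + d₄ * ξs) ≠ 0 := div_ne_zero two_ne_zero hD
  refine ⟨f, hfa, hf0, hfd, hd0, hd2, hne, ?_, ?_⟩
  · intro g hga hg0 hgd
    exact aux_unique F ξs hF f g hfa hga hf0 hg0 hfd hgd
  · exact aux_sqrt f ξs hfa hf0 hd0 (hd2 ▸ hne)
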